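/- arXiv:1710.06788 — 7 statements merged into one kernel-verified Lean document; each statement's English description precedes it below -/
import Mathlib

section
/- For every 0 ≤ R ≤ d, the sum of the squared norms of the POD projection errors of the snapshots satisfies the exact identity (1/K) Σ_{k=1}^{K} ‖u_k − Σ_{i=1}^{R} ⟨u_k, φ_i⟩ φ_i‖² = Σ_{i=R+1}^{d} λ_i. -/
open scoped RealInnerProductSpace

/-- In an orthonormal spanning family, subtracting the part of the expansion indexed by `s` leaves
the coordinates outside `s`. -/
theorem Orthonormal.norm_sub_sum_inner_sq {ι V : Type*} [Fintype ι] [DecidableEq ι]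
    [NormedAddCommGroup V] [InnerProductSpace ℝ V] {φ : ι → V} (hφ : Orthonormal ℝ φ)
    (hspan : Submodule.span ℝ (Set.range φ) = ⊤) (s : Finset ι) (x : V) :
    ‖x - ∑ i ∈ s, ⟪x, φ i⟫ • φ i‖ ^ 2 = ∑ i ∈ sᶜ, ⟪x, φ i⟫ ^ 2 := by
  have hx : ∑ i, ⟪x, φ i⟫ • φ i = x := by
    simpa [real_inner_comm] using (OrthonormalBasis.mk hφ hspan.ge).sum_repr' x
  have hdiff : x - ∑ i ∈ s, ⟪x, φ i⟫ • φ i = ∑ i ∈ sᶜ, ⟪x, φ i⟫ • φ i := by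
    rw [sub_eq_iff_eq_add, Finset.sum_compl_add_sum, hx]
  rw [hdiff, ← real_inner_self_eq_norm_sq, hφ.inner_sum]
  simp [sq]

/-- exact POD projection error identity in the `L²` norm:
`(1/K) Σ_{k=1}^{K} ‖u_k − Σ_{i=1}^{R} ⟨u_k, φ_i⟩ φ_i‖² = Σ_{i=R+1}^{d} λ_i`. -/
theorem pod_projection_error_identity
    {V : Type*} [NormedAddCommGroup V] [InnerProductSpace ℝ V]
    (d K : ℕ) (hK : 0 < K)
    (u : Fin K → V) (φ : Fin d → V) (lam : Fin d → ℝ)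
    (hφ : Orthonormal ℝ φ)
    (hspan : Submodule.span ℝ (Set.range φ) = ⊤)
    (heig : ∀ i : Fin d,
      (K : ℝ)⁻¹ • ∑ k : Fin K, ⟪u k, φ i⟫ • u k = lam i • φ i)
    (hord : ∀ i j : Fin d, i ≤ j → lam j ≤ lam i)
    (hnonneg : ∀ i : Fin d, 0 ≤ lam i)
    (R : ℕ) (hR : R ≤ d) :
    (K : ℝ)⁻¹ *
        ∑ k : Fin K,
          ‖u k - ∑ i ∈ Finset.univ.filter (fun i : Fin d => (i : ℕ) < R),
              ⟪u k, φ i⟫ • φ i‖ ^ 2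
      = ∑ i ∈ Finset.univ.filter (fun i : Fin d => R ≤ (i : ℕ)), lam i := by
  have hlam : ∀ i, (K : ℝ)⁻¹ * ∑ k, ⟪u k, φ i⟫ ^ 2 = lam i := by
    intro i
    have h := congrArg (fun v => ⟪v, φ i⟫) (heig i)
    simpa [real_inner_smul_left, sum_inner, hφ.1 i, sq] using h
  simp_rw [hφ.norm_sub_sum_inner_sq hspan, Finset.compl_filter, not_lt]
  rw [Finset.sum_comm, Finset.mul_sum]
  exact Finset.sum_congr rfl fun i _ => hlam i
end

section
/- For every linear map G : V → W into another real inner product space W and every 0 ≤ R ≤ d, the sum of the squared G-images of the POD projection errors satisfies the exact identity (1/K) Σ_{k=1}^{K} ‖G(u_k − Σ_{i=1}^{R} ⟨u_k, φ_i⟩ φ_i)‖² = Σ_{i=R+1}^{d} λ_i ‖G φ_i‖². (In the paper, G is the gradient operator, so this is the H¹-seminorm identity for the POD projection error.) -/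
open scoped RealInnerProductSpace

/-- Averaged products of coefficients of the snapshots along eigenvectors of the correlation
operator are diagonal. -/
lemma correlation_coeff_eq_ite
    {V : Type*} [NormedAddCommGroup V] [InnerProductSpace ℝ V]
    {ι κ : Type*} [DecidableEq ι] [Fintype κ] {c : ℝ} {u : κ → V} {φ : ι → V} {lam : ι → ℝ}
    (hφ : Orthonormal ℝ φ)
    (heig : ∀ i, c • ∑ k, ⟪u k, φ i⟫ • u k = lam i • φ i) (i j : ι) :
    c * ∑ k, ⟪u k, φ i⟫ * ⟪u k, φ j⟫ = if i = j then lam i else 0 := by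
  have h := congrArg (fun v => ⟪v, φ j⟫) (heig i)
  simpa [real_inner_smul_left, sum_inner, orthonormal_iff_ite.mp hφ i j] using h

/-- Removing the components indexed by `p` from a vector leaves the remaining components. -/
lemma Orthonormal.sub_sum_filter_eq
    {V : Type*} [NormedAddCommGroup V] [InnerProductSpace ℝ V]
    {ι : Type*} [Fintype ι] {φ : ι → V}
    (hφ : Orthonormal ℝ φ) (hspan : Submodule.span ℝ (Set.range φ) = ⊤)
    (p : ι → Prop) [DecidablePred p] (x : V) :
    x - ∑ i with p i, ⟪x, φ i⟫ • φ i = ∑ i with ¬ p i, ⟪x, φ i⟫ • φ i := by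
  have h := (OrthonormalBasis.mk hφ hspan.ge).sum_repr' x
  simp only [OrthonormalBasis.coe_mk, real_inner_comm x] at h
  rw [sub_eq_iff_eq_add', Finset.sum_filter_add_sum_filter_not]
  exact h.symm

/-- The average of the squared norms of partial eigenvector expansions under a linear map. -/
lemma average_norm_map_sum_sq
    {V : Type*} [NormedAddCommGroup V] [InnerProductSpace ℝ V]
    {W : Type*} [NormedAddCommGroup W] [InnerProductSpace ℝ W]
    {ι κ : Type*} [Fintype κ] {c : ℝ} {u : κ → V} {φ : ι → V} {lam : ι → ℝ}
    (hφ : Orthonormal ℝ φ)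
    (heig : ∀ i, c • ∑ k, ⟪u k, φ i⟫ • u k = lam i • φ i)
    (G : V →ₗ[ℝ] W) (s : Finset ι) :
    c * ∑ k, ‖G (∑ i ∈ s, ⟪u k, φ i⟫ • φ i)‖ ^ 2 = ∑ i ∈ s, lam i * ‖G (φ i)‖ ^ 2 := by
  classical
  calc
    _ = c * ∑ k, ∑ i ∈ s, ∑ j ∈ s,
          ⟪u k, φ i⟫ * ⟪u k, φ j⟫ * ⟪G (φ i), G (φ j)⟫ := by
      simp only [← real_inner_self_eq_norm_sq, map_sum, map_smul, sum_inner, inner_sum,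
        real_inner_smul_left, real_inner_smul_right]
      congr! 4
      rw [mul_assoc, real_inner_comm (G _) (G _)]
    _ = ∑ i ∈ s, ∑ j ∈ s,
          (c * ∑ k, ⟪u k, φ i⟫ * ⟪u k, φ j⟫) * ⟪G (φ i), G (φ j)⟫ := by
      rw [Finset.sum_comm, Finset.mul_sum]
      refine Finset.sum_congr rfl fun i _ => ?_
      rw [Finset.sum_comm, Finset.mul_sum]
      refine Finset.sum_congr rfl fun j _ => ?_
      rw [← Finset.sum_mul, mul_assoc]
    _ = _ := by
      refine Finset.sum_congr rfl fun i hi => ?_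
      simp [correlation_coeff_eq_ite hφ heig, hi]

/-- exact POD projection error identity under a linear map `G`
(e.g. the gradient, giving the `H¹`-seminorm identity):
`(1/K) Σ_{k=1}^{K} ‖G(u_k − Σ_{i=1}^{R} ⟨u_k, φ_i⟩ φ_i)‖²
  = Σ_{i=R+1}^{d} λ_i ‖G φ_i‖²`. -/
theorem pod_projection_error_identity_seminorm
    {V : Type*} [NormedAddCommGroup V] [InnerProductSpace ℝ V]
    {W : Type*} [NormedAddCommGroup W] [InnerProductSpace ℝ W]
    (d K : ℕ) (hK : 0 < K)
    (u : Fin K → V) (φ : Fin d → V) (lam : Fin d → ℝ)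
    (hφ : Orthonormal ℝ φ)
    (hspan : Submodule.span ℝ (Set.range φ) = ⊤)
    (heig : ∀ i : Fin d,
      (K : ℝ)⁻¹ • ∑ k : Fin K, ⟪u k, φ i⟫ • u k = lam i • φ i)
    (hord : ∀ i j : Fin d, i ≤ j → lam j ≤ lam i)
    (hnonneg : ∀ i : Fin d, 0 ≤ lam i)
    (G : V →ₗ[ℝ] W)
    (R : ℕ) (hR : R ≤ d) :
    (K : ℝ)⁻¹ *
        ∑ k : Fin K,
          ‖G (u k - ∑ i ∈ Finset.univ.filter (fun i : Fin d => (i : ℕ) < R),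
              ⟪u k, φ i⟫ • φ i)‖ ^ 2
      = ∑ i ∈ Finset.univ.filter (fun i : Fin d => R ≤ (i : ℕ)),
          lam i * ‖G (φ i)‖ ^ 2 := by
  simp only [hφ.sub_sum_filter_eq hspan, not_lt]
  exact average_norm_map_sum_sq hφ heig G _
end

section
/- For every linear map G : V → W into another real inner product space W, every 0 ≤ R ≤ d, and every group index j ∈ {1, …, J_S}, one has (1/(N_S+1)) Σ_{m=0}^{N_S} ‖G(u^{j,m} − Σ_{i=1}^{R} ⟨u^{j,m}, φ_i⟩ φ_i)‖² ≤ J_S Σ_{i=R+1}^{d} λ_i ‖G φ_i‖². -/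
open scoped RealInnerProductSpace

/-- If `c • ∑ k, ⟪v k, φ i⟫ • v k = lam i • φ i` for an orthonormal family `φ`, then the scaled sum
of the squared norms of the images under `G` of the partial expansions of the `v k` over `s`
equals `∑ i ∈ s, lam i * ‖G (φ i)‖ ^ 2`. -/
theorem sum_norm_sq_map_partial_expansion
    {V W ι κ : Type*} [NormedAddCommGroup V] [InnerProductSpace ℝ V]
    [NormedAddCommGroup W] [InnerProductSpace ℝ W] [Fintype κ]
    {v : κ → V} {φ : ι → V} {lam : ι → ℝ} {c : ℝ} (hφ : Orthonormal ℝ φ)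
    (heig : ∀ i, c • ∑ k, ⟪v k, φ i⟫ • v k = lam i • φ i) (G : V →ₗ[ℝ] W) (s : Finset ι) :
    c * ∑ k, ‖G (∑ i ∈ s, ⟪v k, φ i⟫ • φ i)‖ ^ 2 = ∑ i ∈ s, lam i * ‖G (φ i)‖ ^ 2 := by
  classical
  have hcorr (i l : ι) :
      c * ∑ k, ⟪v k, φ i⟫ * ⟪v k, φ l⟫ = if i = l then lam i else 0 := by
    have h := congrArg (fun x => ⟪x, φ l⟫) (heig i)
    simpa [real_inner_smul_left, sum_inner, orthonormal_iff_ite.mp hφ i l] using h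
  calc c * ∑ k, ‖G (∑ i ∈ s, ⟪v k, φ i⟫ • φ i)‖ ^ 2
      = c * ∑ k, ∑ i ∈ s, ∑ l ∈ s, ⟪v k, φ i⟫ * ⟪v k, φ l⟫ * ⟪G (φ i), G (φ l)⟫ := by
        simp only [← real_inner_self_eq_norm_sq, map_sum, map_smul, sum_inner, inner_sum,
          real_inner_smul_left, real_inner_smul_right]
        congr 1
        refine Finset.sum_congr rfl fun k _ => ?_
        rw [Finset.sum_comm]
        refine Finset.sum_congr rfl fun i _ => Finset.sum_congr rfl fun l _ => ?_
        rw [real_inner_comm (G (φ l))]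
        ring
    _ = ∑ i ∈ s, ∑ l ∈ s,
          (c * ∑ k, ⟪v k, φ i⟫ * ⟪v k, φ l⟫) * ⟪G (φ i), G (φ l)⟫ := by
        rw [Finset.sum_comm, Finset.mul_sum]
        refine Finset.sum_congr rfl fun i _ => ?_
        rw [Finset.sum_comm, Finset.mul_sum]
        refine Finset.sum_congr rfl fun l _ => ?_
        rw [← Finset.sum_mul, mul_assoc]
    _ = ∑ i ∈ s, lam i * ‖G (φ i)‖ ^ 2 := by
        refine Finset.sum_congr rfl fun i hi => ?_
        simp [hcorr, hi]

/-- groupwise averaged POD projection error bound under a linear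
map `G`: for snapshots relabeled `u^{j,m}`, `j = 1,…,J_S`, `m = 0,…,N_S`
(so `K = J_S (N_S+1)`), for every `0 ≤ R ≤ d` and every group index `j`,
`(1/(N_S+1)) Σ_{m=0}^{N_S} ‖G(u^{j,m} − Σ_{i=1}^{R} ⟨u^{j,m}, φ_i⟩ φ_i)‖²
  ≤ J_S Σ_{i=R+1}^{d} λ_i ‖G φ_i‖²`. -/
theorem pod_projection_error_groupwise_bound_seminorm
    {V : Type*} [NormedAddCommGroup V] [InnerProductSpace ℝ V]
    {W : Type*} [NormedAddCommGroup W] [InnerProductSpace ℝ W]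
    (d Js Ns : ℕ) (hJs : 0 < Js)
    (u : Fin Js → Fin (Ns + 1) → V) (φ : Fin d → V) (lam : Fin d → ℝ)
    (hφ : Orthonormal ℝ φ)
    (hspan : Submodule.span ℝ (Set.range φ) = ⊤)
    (heig : ∀ i : Fin d,
      ((Js * (Ns + 1) : ℕ) : ℝ)⁻¹ •
          ∑ j : Fin Js, ∑ m : Fin (Ns + 1), ⟪u j m, φ i⟫ • u j m
        = lam i • φ i)
    (hord : ∀ i j : Fin d, i ≤ j → lam j ≤ lam i)
    (hnonneg : ∀ i : Fin d, 0 ≤ lam i)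
    (G : V →ₗ[ℝ] W)
    (R : ℕ) (hR : R ≤ d) (j : Fin Js) :
    ((Ns + 1 : ℕ) : ℝ)⁻¹ *
        ∑ m : Fin (Ns + 1),
          ‖G (u j m - ∑ i ∈ Finset.univ.filter (fun i : Fin d => (i : ℕ) < R),
              ⟪u j m, φ i⟫ • φ i)‖ ^ 2
      ≤ (Js : ℝ) * ∑ i ∈ Finset.univ.filter (fun i : Fin d => R ≤ (i : ℕ)),
          lam i * ‖G (φ i)‖ ^ 2 := by
  have hres (j : Fin Js) (m : Fin (Ns + 1)) :
      u j m - ∑ i ∈ Finset.univ.filter (fun i : Fin d => (i : ℕ) < R), ⟪u j m, φ i⟫ • φ i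
        = ∑ i ∈ Finset.univ.filter (fun i : Fin d => R ≤ (i : ℕ)), ⟪u j m, φ i⟫ • φ i := by
    have hexp : ∑ i, ⟪u j m, φ i⟫ • φ i = u j m := by
      simpa [real_inner_comm] using (OrthonormalBasis.mk hφ hspan.ge).sum_repr' (u j m)
    have hsplit := Finset.sum_filter_add_sum_filter_not Finset.univ
      (fun i : Fin d => (i : ℕ) < R) (fun i => ⟪u j m, φ i⟫ • φ i)
    simp only [not_lt] at hsplit
    rw [sub_eq_iff_eq_add', hsplit, hexp]
  have htotal := sum_norm_sq_map_partial_expansion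
    (v := fun p : Fin Js × Fin (Ns + 1) => u p.1 p.2) hφ
    (fun i => by simpa only [Fintype.sum_prod_type] using heig i) G
    (Finset.univ.filter (fun i : Fin d => R ≤ (i : ℕ)))
  simp only [hres]
  rw [← htotal, Fintype.sum_prod_type, ← mul_assoc]
  have hscale : (Js : ℝ) * ((Js * (Ns + 1) : ℕ) : ℝ)⁻¹ = ((Ns + 1 : ℕ) : ℝ)⁻¹ := by
    have : (Js : ℝ) ≠ 0 := by exact_mod_cast hJs.ne'
    push_cast
    field_simp
  rw [hscale]
  gcongr
  exact Finset.single_le_sum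
    (f := fun j => ∑ m, ‖G (∑ i ∈ Finset.univ.filter (fun i : Fin d => R ≤ (i : ℕ)),
      ⟪u j m, φ i⟫ • φ i)‖ ^ 2)
    (fun _ _ => by positivity) (Finset.mem_univ j)
end

section
/- The POD basis solves the constrained minimization problem defining it: for every 0 ≤ R ≤ d and every orthonormal family ψ_1, …, ψ_R in V, one has (1/K) Σ_{k=1}^{K} ‖u_k − Σ_{i=1}^{R} ⟨u_k, ψ_i⟩ ψ_i‖² ≥ Σ_{i=R+1}^{d} λ_i, and equality holds when ψ_i = φ_i for i = 1, …, R; hence the leading eigenvectors φ_1, …, φ_R minimize the total squared projection error among all orthonormal families of size R, with optimal value Σ_{i=R+1}^{d} λ_i. -/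
open scoped RealInnerProductSpace

section ProjectionError

variable {V : Type*} [NormedAddCommGroup V] [InnerProductSpace ℝ V]

theorem Orthonormal.norm_sub_sum_inner_smul_sq {ι : Type*} [Fintype ι] {ψ : ι → V}
    (hψ : Orthonormal ℝ ψ) (x : V) :
    ‖x - ∑ i, ⟪x, ψ i⟫ • ψ i‖ ^ 2 = ‖x‖ ^ 2 - ∑ i, ⟪x, ψ i⟫ ^ 2 := by
  have h_cross : ⟪x, ∑ i, ⟪x, ψ i⟫ • ψ i⟫ = ∑ i, ⟪x, ψ i⟫ ^ 2 := by
    simp [inner_sum, inner_smul_right, sq]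
  have h_norm : ‖∑ i, ⟪x, ψ i⟫ • ψ i‖ ^ 2 = ∑ i, ⟪x, ψ i⟫ ^ 2 := by
    rw [← real_inner_self_eq_norm_sq, hψ.inner_sum]
    simp [sq]
  rw [norm_sub_sq_real, h_cross, h_norm]
  ring

variable {ι κ : Type*} [Fintype ι] [Fintype κ]

theorem mul_sum_inner_sq_of_eigenbasis (b : OrthonormalBasis ι ℝ V) (u : κ → V)
    (lam : ι → ℝ) (c : ℝ) (heig : ∀ i, c • ∑ k, ⟪u k, b i⟫ • u k = lam i • b i) (x : V) :
    c * ∑ k, ⟪u k, x⟫ ^ 2 = ∑ j, lam j * ⟪b j, x⟫ ^ 2 := by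
  have h_inner (j : ι) : c * ∑ k, ⟪u k, b j⟫ * ⟪u k, x⟫ = lam j * ⟪b j, x⟫ := by
    simpa [inner_smul_left, sum_inner] using congrArg (fun v => ⟪v, x⟫) (heig j)
  calc c * ∑ k, ⟪u k, x⟫ ^ 2
      = c * ∑ k, (∑ j, ⟪u k, b j⟫ * ⟪b j, x⟫) * ⟪u k, x⟫ := by
        simp only [b.sum_inner_mul_inner, sq]
    _ = ∑ j, (c * ∑ k, ⟪u k, b j⟫ * ⟪u k, x⟫) * ⟪b j, x⟫ := by
        simp only [Finset.sum_mul, Finset.mul_sum]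
        rw [Finset.sum_comm]
        exact Finset.sum_congr rfl fun j _ => Finset.sum_congr rfl fun k _ => by ring
    _ = ∑ j, lam j * ⟪b j, x⟫ ^ 2 :=
        Finset.sum_congr rfl fun j _ => by rw [h_inner]; ring

theorem mul_sum_norm_sq_of_eigenbasis (b : OrthonormalBasis ι ℝ V) (u : κ → V)
    (lam : ι → ℝ) (c : ℝ) (heig : ∀ i, c • ∑ k, ⟪u k, b i⟫ • u k = lam i • b i) :
    c * ∑ k, ‖u k‖ ^ 2 = ∑ j, lam j := by
  classical
  have h_norm (k : κ) : ‖u k‖ ^ 2 = ∑ j, ⟪u k, b j⟫ ^ 2 := by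
    rw [← real_inner_self_eq_norm_sq, ← b.sum_inner_mul_inner]
    exact Finset.sum_congr rfl fun j _ => by rw [real_inner_comm (u k) (b j), sq]
  simp only [h_norm]
  rw [Finset.sum_comm, Finset.mul_sum]
  refine Finset.sum_congr rfl fun j _ => ?_
  rw [mul_sum_inner_sq_of_eigenbasis b u lam c heig]
  simp [b.inner_eq_ite]

theorem mul_sum_projection_error_of_eigenbasis {τ : Type*} [Fintype τ]
    (b : OrthonormalBasis ι ℝ V) (u : κ → V) (lam : ι → ℝ) (c : ℝ)
    (heig : ∀ i, c • ∑ k, ⟪u k, b i⟫ • u k = lam i • b i)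
    {ψ : τ → V} (hψ : Orthonormal ℝ ψ) :
    c * ∑ k, ‖u k - ∑ i, ⟪u k, ψ i⟫ • ψ i‖ ^ 2 =
      ∑ j, lam j * (1 - ∑ i, ⟪b j, ψ i⟫ ^ 2) := by
  simp only [hψ.norm_sub_sum_inner_smul_sq, Finset.sum_sub_distrib, mul_sub, mul_one]
  rw [mul_sum_norm_sq_of_eigenbasis b u lam c heig, Finset.sum_comm, Finset.mul_sum]
  simp only [mul_sum_inner_sq_of_eigenbasis b u lam c heig, Finset.mul_sum]
  rw [Finset.sum_comm]

theorem Orthonormal.sum_inner_sq_le_one {τ : Type*} [Fintype τ] {ψ : τ → V}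
    (hψ : Orthonormal ℝ ψ) {x : V} (hx : ‖x‖ = 1) : ∑ i, ⟪x, ψ i⟫ ^ 2 ≤ 1 := by
  have h := hψ.norm_sub_sum_inner_smul_sq x
  rw [hx] at h
  nlinarith [sq_nonneg ‖x - ∑ i, ⟪x, ψ i⟫ • ψ i‖]

theorem OrthonormalBasis.sum_sum_inner_sq {τ : Type*} [Fintype τ] (b : OrthonormalBasis ι ℝ V)
    {ψ : τ → V} (hψ : Orthonormal ℝ ψ) :
    ∑ j, ∑ i, ⟪b j, ψ i⟫ ^ 2 = Fintype.card τ := by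
  rw [Finset.sum_comm]
  have h_unit (i : τ) : ∑ j, ⟪b j, ψ i⟫ ^ 2 = 1 := by
    have h := b.sum_inner_mul_inner (ψ i) (ψ i)
    rw [real_inner_self_eq_norm_sq, hψ.1 i, one_pow] at h
    rw [← h]
    exact Finset.sum_congr rfl fun j _ => by rw [real_inner_comm (ψ i) (b j), sq]
  simp [h_unit]

end ProjectionError

theorem Antitone.sum_tail_le_sum_mul_one_sub {d R : ℕ} (hR : R ≤ d) {lam w : Fin d → ℝ}
    (hlam : Antitone lam) (hw_nonneg : ∀ j, 0 ≤ w j) (hw_le : ∀ j, w j ≤ 1)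
    (hw_sum : ∑ j, w j = R) :
    ∑ j ∈ Finset.univ.filter (fun j : Fin d => R ≤ (j : ℕ)), lam j ≤ ∑ j, lam j * (1 - w j) := by
  obtain ⟨m, hm_le, hm_ge⟩ :
      ∃ m, (∀ j : Fin d, (j : ℕ) < R → m ≤ lam j) ∧ ∀ j : Fin d, R ≤ (j : ℕ) → lam j ≤ m := by
    rcases hR.lt_or_eq with h | rfl
    · exact ⟨lam ⟨R, h⟩, fun j hj => hlam (Fin.le_def.2 hj.le), fun j hj => hlam (Fin.le_def.2 hj)⟩
    · obtain ⟨m, hm⟩ := (Set.finite_range lam).bddBelow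
      exact ⟨m, fun j _ => hm ⟨j, rfl⟩, fun j hj => absurd j.isLt hj.not_gt⟩
  have h_card : ∑ j : Fin d, (if R ≤ (j : ℕ) then (1 : ℝ) else 0) = d - R := by
    rw [Fin.sum_univ_eq_sum_range (fun j => if R ≤ j then (1 : ℝ) else 0) d,
      ← Finset.sum_range_add_sum_Ico _ hR,
      Finset.sum_eq_zero fun j hj => if_neg (Finset.mem_range.1 hj).not_ge,
      Finset.sum_congr rfl fun j hj => if_pos (Finset.mem_Ico.1 hj).1]
    simp [Nat.cast_sub hR]
  have h_term : 0 ≤ ∑ j, (lam j - m) * (1 - w j - if R ≤ (j : ℕ) then (1 : ℝ) else 0) := by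
    refine Finset.sum_nonneg fun j _ => ?_
    split_ifs with h
    · nlinarith [hm_ge j h, hw_nonneg j]
    · nlinarith [hm_le j (not_le.1 h), hw_le j]
  have h_expand : ∑ j, (lam j - m) * (1 - w j - if R ≤ (j : ℕ) then (1 : ℝ) else 0) =
      ∑ j, lam j * (1 - w j) - ∑ j ∈ Finset.univ.filter (fun j : Fin d => R ≤ (j : ℕ)), lam j := by
    have h_split (j : Fin d) : (lam j - m) * (1 - w j - if R ≤ (j : ℕ) then (1 : ℝ) else 0) =
        lam j * (1 - w j) - (if R ≤ (j : ℕ) then lam j else 0) -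
          m * (1 - w j - if R ≤ (j : ℕ) then (1 : ℝ) else 0) := by
      split_ifs <;> ring
    rw [Finset.sum_congr rfl fun j _ => h_split j, Finset.sum_sub_distrib, Finset.sum_sub_distrib,
      ← Finset.mul_sum, Finset.sum_sub_distrib, Finset.sum_sub_distrib, h_card, hw_sum,
      Finset.sum_filter]
    simp
  linarith


/-- the POD basis solves the constrained minimization problem:
for every `0 ≤ R ≤ d` and every orthonormal family `ψ_1, …, ψ_R` in `V`,
`(1/K) Σ_{k=1}^{K} ‖u_k − Σ_{i=1}^{R} ⟨u_k, ψ_i⟩ ψ_i‖² ≥ Σ_{i=R+1}^{d} λ_i`,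
with equality when `ψ_i = φ_i` for `i = 1, …, R`. -/
theorem pod_basis_optimality
    {V : Type*} [NormedAddCommGroup V] [InnerProductSpace ℝ V]
    (d K : ℕ) (hK : 0 < K)
    (u : Fin K → V) (φ : Fin d → V) (lam : Fin d → ℝ)
    (hφ : Orthonormal ℝ φ)
    (hspan : Submodule.span ℝ (Set.range φ) = ⊤)
    (heig : ∀ i : Fin d,
      (K : ℝ)⁻¹ • ∑ k : Fin K, ⟪u k, φ i⟫ • u k = lam i • φ i)
    (hord : ∀ i j : Fin d, i ≤ j → lam j ≤ lam i)
    (hnonneg : ∀ i : Fin d, 0 ≤ lam i)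
    (R : ℕ) (hR : R ≤ d) :
    (∀ ψ : Fin R → V, Orthonormal ℝ ψ →
      ∑ i ∈ Finset.univ.filter (fun i : Fin d => R ≤ (i : ℕ)), lam i ≤
        (K : ℝ)⁻¹ *
          ∑ k : Fin K, ‖u k - ∑ i : Fin R, ⟪u k, ψ i⟫ • ψ i‖ ^ 2)
    ∧
    (K : ℝ)⁻¹ *
        ∑ k : Fin K,
          ‖u k - ∑ i : Fin R, ⟪u k, φ (Fin.castLE hR i)⟫ • φ (Fin.castLE hR i)‖ ^ 2
      = ∑ i ∈ Finset.univ.filter (fun i : Fin d => R ≤ (i : ℕ)), lam i := by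
  set b : OrthonormalBasis (Fin d) ℝ V := OrthonormalBasis.mk hφ hspan.ge with hb
  have hbφ (i : Fin d) : b i = φ i := by simp [hb]
  simp only [← hbφ] at heig ⊢
  refine ⟨fun ψ hψ => ?_, ?_⟩
  · rw [mul_sum_projection_error_of_eigenbasis b u lam _ heig hψ]
    refine Antitone.sum_tail_le_sum_mul_one_sub hR (fun i j => hord i j)
      (fun j => Finset.sum_nonneg fun i _ => sq_nonneg _)
      (fun j => hψ.sum_inner_sq_le_one (b.norm_eq_one j)) ?_
    simpa using b.sum_sum_inner_sq hψ
  · have h_orth : Orthonormal ℝ fun i => b (Fin.castLE hR i) :=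
      b.orthonormal.comp _ (Fin.castLE_injective hR)
    rw [mul_sum_projection_error_of_eigenbasis b u lam _ heig h_orth, Finset.sum_filter]
    refine Finset.sum_congr rfl fun j _ => ?_
    simp only [b.inner_eq_ite]
    split_ifs with h
    · rw [Finset.sum_eq_zero, sub_zero, mul_one]
      intro i _
      have hne : j ≠ Fin.castLE hR i := by
        rintro rfl
        exact absurd i.isLt (not_lt.2 h)
      simp [hne]
    · rw [Finset.sum_eq_single ⟨j, not_le.1 h⟩]
      · simp
      · intro i _ hi
        have hne : j ≠ Fin.castLE hR i := by
          rintro rfl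
          exact hi rfl
        simp [hne]
      · simp
end

section
/- ROM filter stability in the L² norm: for every v ∈ V, the filtered element satisfies ‖v̄‖ ≤ ‖v‖. -/
open scoped RealInnerProductSpace

/-- ROM filter stability in the `L²` norm: for every `v ∈ V`,
the POD-differential-filtered element `v̄` satisfies `‖v̄‖ ≤ ‖v‖`. -/
theorem pod_filter_L2_stability
    {V : Type*} [NormedAddCommGroup V] [InnerProductSpace ℝ V]
    {W : Type*} [NormedAddCommGroup W] [InnerProductSpace ℝ W]
    (G : V →ₗ[ℝ] W) (XR : Submodule ℝ V) [FiniteDimensional ℝ XR]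
    (δ : ℝ) (hδ : 0 < δ) (v : V)
    (vbar : V) (hmem : vbar ∈ XR)
    (hfilt : ∀ φ ∈ XR, δ ^ 2 * ⟪G vbar, G φ⟫ + ⟪vbar, φ⟫ = ⟪v, φ⟫) :
    ‖vbar‖ ≤ ‖v‖ := by
  have h := hfilt vbar hmem
  rw [real_inner_self_eq_norm_sq, real_inner_self_eq_norm_sq] at h
  have hcs : ⟪v, vbar⟫ ≤ ‖v‖ * ‖vbar‖ := real_inner_le_norm v vbar
  have hG : 0 ≤ δ ^ 2 * ‖G vbar‖ ^ 2 := by positivity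
  by_contra! hlt
  nlinarith [mul_pos (sub_pos.mpr hlt) ((norm_nonneg v).trans_lt hlt)]
end

section
/- ROM filter stability in the gradient norm: for every v ∈ V, the filtered element satisfies ‖G v̄‖ ≤ ‖S_R‖₂^{1/2} ‖v‖. -/
open scoped RealInnerProductSpace

/-- The inverse inequality for a linear map on the span of an orthonormal family, in terms of the
spectral norm of the Gram matrix of the images. -/
theorem Orthonormal.norm_sq_map_le_of_mem_span
    {V : Type*} [NormedAddCommGroup V] [InnerProductSpace ℝ V]
    {W : Type*} [NormedAddCommGroup W] [InnerProductSpace ℝ W]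
    {ι : Type*} [Fintype ι] [DecidableEq ι] {φ : ι → V} (hφ : Orthonormal ℝ φ)
    (G : V →ₗ[ℝ] W) {S : Matrix ι ι ℝ} (hS : ∀ i j, S i j = ⟪G (φ i), G (φ j)⟫)
    {x : V} (hx : x ∈ Submodule.span ℝ (Set.range φ)) :
    ‖G x‖ ^ 2 ≤ ‖Matrix.toEuclideanCLM (𝕜 := ℝ) S‖ * ‖x‖ ^ 2 := by
  obtain ⟨c, rfl⟩ := (Submodule.mem_span_range_iff_exists_fun ℝ).1 hx
  set u : EuclideanSpace ℝ ι := WithLp.toLp 2 c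
  have hnorm : ‖∑ i, c i • φ i‖ ^ 2 = ‖u‖ ^ 2 := by
    rw [← real_inner_self_eq_norm_sq, hφ.inner_sum, EuclideanSpace.real_norm_sq_eq]
    simp [u, sq]
  have hgram : ‖G (∑ i, c i • φ i)‖ ^ 2 = ⟪u, Matrix.toEuclideanCLM (𝕜 := ℝ) S u⟫ := by
    rw [← real_inner_self_eq_norm_sq, map_sum, sum_inner, PiLp.inner_apply]
    refine Finset.sum_congr rfl fun i _ => ?_
    simp only [map_smul, inner_sum, inner_smul_left, inner_smul_right, u,
      Matrix.toEuclideanCLM_toLp, Matrix.mulVec, dotProduct, hS,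
      RCLike.inner_apply, Finset.sum_mul, conj_trivial]
    exact Finset.sum_congr rfl fun j _ => by ring
  rw [hgram, hnorm]
  calc ⟪u, Matrix.toEuclideanCLM (𝕜 := ℝ) S u⟫
      ≤ ‖u‖ * ‖Matrix.toEuclideanCLM (𝕜 := ℝ) S u‖ := real_inner_le_norm _ _
    _ ≤ ‖u‖ * (‖Matrix.toEuclideanCLM (𝕜 := ℝ) S‖ * ‖u‖) := by
      gcongr
      exact ContinuousLinearMap.le_opNorm _ _
    _ = ‖Matrix.toEuclideanCLM (𝕜 := ℝ) S‖ * ‖u‖ ^ 2 := by ring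

/-- ROM filter stability in the gradient norm: for every `v ∈ V`,
the POD-differential-filtered element `v̄ ∈ X_R = span{φ_1,…,φ_R}` satisfies
`‖G v̄‖ ≤ ‖S_R‖₂^{1/2} ‖v‖`, where `(S_R)_{ij} = ⟨G φ_i, G φ_j⟩` and `‖S_R‖₂`
is its spectral norm. -/
theorem pod_filter_gradient_stability
    {V : Type*} [NormedAddCommGroup V] [InnerProductSpace ℝ V]
    {W : Type*} [NormedAddCommGroup W] [InnerProductSpace ℝ W]
    (R : ℕ) (φ : Fin R → V) (hφ : Orthonormal ℝ φ)
    (G : V →ₗ[ℝ] W)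
    (S : Matrix (Fin R) (Fin R) ℝ)
    (hS : ∀ i j : Fin R, S i j = ⟪G (φ i), G (φ j)⟫)
    (s : ℝ) (hs : s = ‖Matrix.toEuclideanCLM (𝕜 := ℝ) S‖)
    (δ : ℝ) (hδ : 0 < δ) (v : V)
    (vbar : V) (hmem : vbar ∈ Submodule.span ℝ (Set.range φ))
    (hfilt : ∀ ψ ∈ Submodule.span ℝ (Set.range φ),
      δ ^ 2 * ⟪G vbar, G ψ⟫ + ⟪vbar, ψ⟫ = ⟪v, ψ⟫) :
    ‖G vbar‖ ≤ Real.sqrt s * ‖v‖ := by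
  have hstab : ‖vbar‖ ≤ ‖v‖ := by
    have henergy := hfilt vbar hmem
    rw [real_inner_self_eq_norm_sq, real_inner_self_eq_norm_sq] at henergy
    have hcs := real_inner_le_norm v vbar
    have hgrad : 0 ≤ δ ^ 2 * ‖G vbar‖ ^ 2 := by positivity
    by_contra! hlt
    nlinarith [norm_nonneg v]
  have hinv : ‖G vbar‖ ≤ Real.sqrt s * ‖vbar‖ := by
    have h := Real.sqrt_le_sqrt (hφ.norm_sq_map_le_of_mem_span G hS hmem)
    rwa [← hs, Real.sqrt_sq (norm_nonneg _), Real.sqrt_mul' _ (sq_nonneg _),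
      Real.sqrt_sq (norm_nonneg _)] at h
  exact hinv.trans (by gcongr)
end

section
/- ROM filter gradient stability on the reduced space: if v ∈ X_R, then the filtered element satisfies ‖G v̄‖ ≤ ‖G v‖. -/
open scoped RealInnerProductSpace

/-- ROM filter gradient stability on the reduced space:
if `v ∈ X_R`, then the POD-differential-filtered element `v̄` satisfies
`‖G v̄‖ ≤ ‖G v‖`. -/
theorem pod_filter_gradient_stability_on_XR
    {V : Type*} [NormedAddCommGroup V] [InnerProductSpace ℝ V]
    {W : Type*} [NormedAddCommGroup W] [InnerProductSpace ℝ W]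
    (G : V →ₗ[ℝ] W) (XR : Submodule ℝ V) [FiniteDimensional ℝ XR]
    (δ : ℝ) (hδ : 0 < δ) (v : V) (hv : v ∈ XR)
    (vbar : V) (hmem : vbar ∈ XR)
    (hfilt : ∀ φ ∈ XR, δ ^ 2 * ⟪G vbar, G φ⟫ + ⟪vbar, φ⟫ = ⟪v, φ⟫) :
    ‖G vbar‖ ≤ ‖G v‖ := by
  have hgap : δ ^ 2 * ⟪G vbar, G (v - vbar)⟫ = ⟪v - vbar, v - vbar⟫ := by
    rw [inner_sub_left v vbar (v - vbar)]
    linarith [hfilt (v - vbar) (XR.sub_mem hv hmem)]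
  have hnonneg : 0 ≤ ⟪G vbar, G (v - vbar)⟫ :=
    nonneg_of_mul_nonneg_right (hgap ▸ real_inner_self_nonneg) (by positivity)
  rw [map_sub, inner_sub_right, real_inner_self_eq_norm_mul_norm] at hnonneg
  have hcs := real_inner_le_norm (G vbar) (G v)
  by_contra! hlt
  nlinarith [norm_nonneg (G v)]
end
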